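/- Let Q ∈ ℝ^{n×n} be symmetric positive definite with smallest eigenvalue λ_min(Q), let t* > 0, N̄ > 0, and let x : [0,t*] → ℝ^n be differentiable with ‖x′(t)‖ ≤ N̄ for all t ∈ [0,t*]. Suppose δ := ‖x(0)‖/(2N̄) ≤ t*, and let v : [0,δ] → ℝ be differentiable with v′(t) ≤ −x(t)ᵀQx(t) for all t ∈ [0,δ] and v(δ) ≥ 0. Then v(0) ≥ (λ_min(Q)/(8N̄)) · ‖x(0)‖³. -/

import Mathlib

open MeasureTheory Matrix Set

/-- Rayleigh's inequality: the smallest eigenvalue bounds the quadratic form from below. -/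
theorem Matrix.IsHermitian.iInf_eigenvalues_mul_norm_sq_le {ι : Type*} [Fintype ι] [DecidableEq ι]
    {A : Matrix ι ι ℝ} (hA : A.IsHermitian) (y : EuclideanSpace ℝ ι) :
    (⨅ i, hA.eigenvalues i) * ‖y‖ ^ 2 ≤ y ⬝ᵥ A *ᵥ y := by
  have hsymm : (toEuclideanLin A).IsSymmetric := isSymmetric_toEuclideanLin_iff.2 hA
  have heig (i : ι) : toEuclideanLin A (hA.eigenvectorBasis i) =
      hA.eigenvalues i • hA.eigenvectorBasis i := by
    ext j
    simpa [toEuclideanLin] using congrFun (hA.mulVec_eigenvectorBasis i) j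
  have hform : y ⬝ᵥ A *ᵥ y = inner ℝ y (toEuclideanLin A y) := by
    simp [toEuclideanLin, EuclideanSpace.inner_eq_star_dotProduct, dotProduct_comm]
  rw [hform, ← hA.eigenvectorBasis.sum_inner_mul_inner, ← hA.eigenvectorBasis.sum_sq_inner_right,
    Finset.mul_sum]
  refine Finset.sum_le_sum fun i _ => ?_
  rw [← hsymm, heig, real_inner_smul_left, real_inner_comm y]
  have := mul_le_mul_of_nonneg_right (ciInf_le (finite_range hA.eigenvalues).bddBelow i)
    (sq_nonneg (inner ℝ y (hA.eigenvectorBasis i)))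
  linarith

/-- A function whose derivative on `[a, b]` is at most `C` grows by at most `C * (b - a)`. -/
theorem sub_le_mul_sub_of_hasDerivWithinAt_le {f f' : ℝ → ℝ} {a b C : ℝ} (hab : a ≤ b)
    (hf : ∀ t ∈ Icc a b, HasDerivWithinAt f (f' t) (Icc a b) t)
    (hC : ∀ t ∈ Icc a b, f' t ≤ C) : f b - f a ≤ C * (b - a) := by
  have hB (t : ℝ) : HasDerivAt (fun s => f a + C * (s - a)) C t := by
    simpa using (((hasDerivAt_id t).sub_const a).const_mul C).const_add (f a)
  have := image_le_of_deriv_right_le_deriv_boundary (f := f) (f' := f')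
    (B := fun s => f a + C * (s - a)) (B' := fun _ => C)
    (fun t ht => (hf t ht).continuousWithinAt)
    (fun t ht => (hf t (Ico_subset_Icc_self ht)).mono_of_mem_nhdsWithin
      (Icc_mem_nhdsGE_of_mem ht))
    (by simp) (fun t _ => (hB t).continuousAt.continuousWithinAt)
    (fun t _ => (hB t).hasDerivWithinAt)
    (fun t ht => hC t (Ico_subset_Icc_self ht)) (right_mem_Icc.2 hab)
  linarith

/-- **cubic lower bound of Proposition 4.1.** Let `Q` be symmetric positive
definite with smallest eigenvalue `λ_min(Q)`, let `x : [0,t*] → ℝ^n` be differentiable with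
`‖x′‖ ≤ N̄`, let `δ = ‖x(0)‖/(2N̄) ≤ t*`, and let `v : [0,δ] → ℝ` be differentiable with
`v′(t) ≤ -x(t)ᵀQx(t)` and `v(δ) ≥ 0`. Then `v(0) ≥ (λ_min(Q)/(8N̄)) ‖x(0)‖³`. -/
theorem bellman_functional_cubic_lower_bound {n : ℕ}
    (Q : Matrix (Fin n) (Fin n) ℝ) (hQ : Q.PosDef)
    (tstar Nbar : ℝ) (htstar : 0 < tstar) (hNbar : 0 < Nbar)
    (x x' : ℝ → EuclideanSpace ℝ (Fin n))
    (hxderiv : ∀ t ∈ Set.Icc (0:ℝ) tstar, HasDerivWithinAt x (x' t) (Set.Icc 0 tstar) t)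
    (hx'bound : ∀ t ∈ Set.Icc (0:ℝ) tstar, ‖x' t‖ ≤ Nbar)
    (hδ : ‖x 0‖ / (2 * Nbar) ≤ tstar)
    (v v' : ℝ → ℝ)
    (hvderiv : ∀ t ∈ Set.Icc (0:ℝ) (‖x 0‖ / (2 * Nbar)),
      HasDerivWithinAt v (v' t) (Set.Icc 0 (‖x 0‖ / (2 * Nbar))) t)
    (hv'le : ∀ t ∈ Set.Icc (0:ℝ) (‖x 0‖ / (2 * Nbar)),
      v' t ≤ -(x t ⬝ᵥ Q.mulVec (x t)))
    (hvδ : 0 ≤ v (‖x 0‖ / (2 * Nbar))) :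
    ((⨅ i, hQ.1.eigenvalues i) / (8 * Nbar)) * ‖x 0‖ ^ 3 ≤ v 0 := by
  set δ := ‖x 0‖ / (2 * Nbar) with hδ_def
  have hδ0 : 0 ≤ δ := by positivity
  have hNδ : Nbar * δ = ‖x 0‖ / 2 := by
    rw [hδ_def]
    field_simp
  set l := ⨅ i, hQ.1.eigenvalues i
  have hl : 0 ≤ l := Real.iInf_nonneg fun i => (hQ.eigenvalues_pos i).le
  have hx_lower : ∀ t ∈ Icc 0 δ, ‖x 0‖ / 2 ≤ ‖x t‖ := by
    intro t ht
    have hdist := (convex_Icc 0 tstar).norm_image_sub_le_of_norm_hasDerivWithin_le hxderiv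
      hx'bound (left_mem_Icc.2 htstar.le) ⟨ht.1, ht.2.trans hδ⟩
    rw [sub_zero, Real.norm_of_nonneg ht.1] at hdist
    have htδ := mul_le_mul_of_nonneg_left ht.2 hNbar.le
    have htri := norm_sub_norm_le (x 0) (x t)
    rw [norm_sub_rev] at htri
    linarith
  have hv'_le : ∀ t ∈ Icc 0 δ, v' t ≤ -(l * (‖x 0‖ / 2) ^ 2) := by
    intro t ht
    have hquad := hQ.1.iInf_eigenvalues_mul_norm_sq_le (x t)
    have hnorm : l * (‖x 0‖ / 2) ^ 2 ≤ l * ‖x t‖ ^ 2 := by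
      gcongr
      exact hx_lower t ht
    linarith [hv'le t ht]
  have hdecay := sub_le_mul_sub_of_hasDerivWithinAt_le hδ0 hvderiv hv'_le
  have hcubic : l / (8 * Nbar) * ‖x 0‖ ^ 3 = l * (‖x 0‖ / 2) ^ 2 * δ := by
    rw [hδ_def]
    field_simp
    ring
  linarith
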